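/- The language L_∪ = {w ∈ {a,b,c}* \ {ε} : w contains strictly more occurrences of c than of b, or strictly more occurrences of c than of a} is not binary-PODWA-recognizable; that is, there is no DWA A over {a,b,c} such that for every nonempty word w, A(w) > 0 if and only if w ∈ L_∪. -/

import Mathlib

/-- A deterministic weighted automaton (DWA) over alphabet `A` with state space `Q`. -/
structure DWA (A : Type) (Q : Type) where
  init : Q
  δ : Q → A → Q
  c : Q → A → ℤ

/-- The extended transition function `δ̂`. -/
def DWA.run {A Q : Type} (M : DWA A Q) (q : Q) (w : List A) : Q :=
  w.foldl M.δ q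

/-- The accumulated weight of the run on `w` starting in state `q`. -/
def DWA.valFrom {A Q : Type} (M : DWA A Q) : Q → List A → ℤ
  | _, [] => 0
  | q, x :: w => M.c q x + M.valFrom (M.δ q x) w

/-- The value `A(w)` of a word: the sum of the weights along the run from the initial state. -/
def DWA.val {A Q : Type} (M : DWA A Q) (w : List A) : ℤ :=
  M.valFrom M.init w

/-- The three-letter alphabet `{a, b, c}`. -/
inductive ABC where
  | a : ABC
  | b : ABC
  | c : ABC
deriving DecidableEq

theorem DWA.run_append {A Q : Type} (M : DWA A Q) (q : Q) (u w : List A) :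
    M.run q (u ++ w) = M.run (M.run q u) w := by
  simp [DWA.run]

theorem DWA.valFrom_append {A Q : Type} (M : DWA A Q) (u w : List A) : ∀ q : Q,
    M.valFrom q (u ++ w) = M.valFrom q u + M.valFrom (M.run q u) w := by
  induction u with
  | nil => intro q; simp [DWA.valFrom, DWA.run]
  | cons x u ih =>
    intro q
    simp only [List.cons_append, DWA.valFrom, ih]
    simp [DWA.run, add_assoc]

/-- The `n`-fold repetition of a word. -/
def rep {A : Type} (w : List A) : ℕ → List A
  | 0 => []
  | n + 1 => w ++ rep w n

theorem rep_count {A : Type} [DecidableEq A] (w : List A) (x : A) (n : ℕ) :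
    (rep w n).count x = n * w.count x := by
  induction n with
  | zero => simp [rep]
  | succ n ih => simp [rep, ih]; ring

theorem DWA.run_rep {A Q : Type} (M : DWA A Q) (q : Q) (w : List A) (h : M.run q w = q) (n : ℕ) :
    M.run q (rep w n) = q := by
  induction n with
  | zero => simp [rep, DWA.run]
  | succ n ih => simp only [rep, DWA.run_append, h, ih]

theorem DWA.valFrom_rep {A Q : Type} (M : DWA A Q) (q : Q) (w : List A) (h : M.run q w = q)
    (n : ℕ) : M.valFrom q (rep w n) = n * M.valFrom q w := by
  induction n with
  | zero => simp [rep, DWA.valFrom]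
  | succ n ih => simp only [rep, DWA.valFrom_append, h, ih]; push_cast; ring

/-- Some reachable state can be reached again after any word. -/
theorem DWA.exists_recurrent {A Q : Type} [Finite Q] (M : DWA A Q) :
    ∃ u : List A, ∀ w, ∃ r, M.run (M.run (M.run M.init u) w) r = M.run M.init u := by
  let S : List A → Set Q := fun u => {s | ∃ w, M.run (M.run M.init u) w = s}
  obtain ⟨u, hu⟩ : ∃ u, ∀ v, (S u).ncard ≤ (S v).ncard := by
    obtain ⟨u, hu⟩ := Function.argmin_le (fun u => (S u).ncard) |> fun h =>
      (⟨Function.argmin (fun u => (S u).ncard), fun v => h v⟩ :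
        ∃ u, ∀ v, (S u).ncard ≤ (S v).ncard)
    exact ⟨u, hu⟩
  refine ⟨u, fun w => ?_⟩
  have hsub : S (u ++ w) ⊆ S u := by
    rintro s ⟨x, hx⟩
    exact ⟨w ++ x, by rw [← hx, M.run_append, M.run_append]⟩
  have heq := Set.eq_of_subset_of_ncard_le hsub (hu _) (Set.toFinite _)
  have hq : M.run M.init u ∈ S (u ++ w) := by
    rw [heq]; exact ⟨[], rfl⟩
  obtain ⟨r, hr⟩ := hq
  exact ⟨r, by rw [← M.run_append M.init]; exact hr⟩

theorem DWA.exists_bounded {A Q : Type} [Finite Q] (M : DWA A Q) :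
    ∃ (u : List A) (R : ℕ), ∀ w, ∃ r, r.length ≤ R ∧
      M.run (M.run M.init u) (w ++ r) = M.run M.init u := by
  obtain ⟨u, hu⟩ := M.exists_recurrent
  have h : ∀ s : Q, ∃ r : List A, (∃ w, M.run (M.run M.init u) w = s) →
      M.run s r = M.run M.init u := by
    intro s
    by_cases hs : ∃ w, M.run (M.run M.init u) w = s
    · obtain ⟨w, rfl⟩ := hs
      obtain ⟨r, hr⟩ := hu w
      exact ⟨r, fun _ => hr⟩
    · exact ⟨[], fun h => absurd h hs⟩
  choose r hr using h
  obtain ⟨R, hR⟩ := (Set.finite_range fun s => (r s).length).bddAbove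
  refine ⟨u, R, fun w => ⟨r (M.run (M.run M.init u) w), hR ⟨_, rfl⟩, ?_⟩⟩
  rw [M.run_append]
  exact hr _ ⟨w, rfl⟩

/-- the language `L_∪` of nonempty words over `{a,b,c}` containing strictly more
`c`'s than `b`'s, or strictly more `c`'s than `a`'s, is not binary-PODWA-recognizable. -/
theorem lcup_not_binary_podwa_recognizable :
    ¬ ∃ (Q : Type) (_ : Fintype Q) (M : DWA ABC Q),
        ∀ w : List ABC, w ≠ [] →
          (0 < M.val w ↔
            (w.count ABC.b < w.count ABC.c ∨ w.count ABC.a < w.count ABC.c)) := by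
  rintro ⟨Q, _, M, hM⟩
  obtain ⟨u, R, hu⟩ := M.exists_bounded
  obtain ⟨N, hN⟩ : ∃ N, N = 2 * R + 1 := ⟨_, rfl⟩
  obtain ⟨r, hrR, hr⟩ := hu (List.replicate (3 * N) ABC.b ++ List.replicate N ABC.c)
  obtain ⟨s, hsR, hs⟩ := hu (List.replicate (3 * N) ABC.a ++ List.replicate N ABC.c)
  set α := (List.replicate (3 * N) ABC.b ++ List.replicate N ABC.c) ++ r with hα
  set β := (List.replicate (3 * N) ABC.a ++ List.replicate N ABC.c) ++ s with hβ
  set q := M.run M.init u with hq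
  have key : ∀ m n : ℕ, 0 < m + n →
      (0 < M.val u + m * M.valFrom q α + n * M.valFrom q β ↔
        (u.count ABC.b + m * α.count ABC.b + n * β.count ABC.b <
          u.count ABC.c + m * α.count ABC.c + n * β.count ABC.c ∨
        u.count ABC.a + m * α.count ABC.a + n * β.count ABC.a <
          u.count ABC.c + m * α.count ABC.c + n * β.count ABC.c)) := by
    intro m n hmn
    have hne : u ++ rep α m ++ rep β n ≠ [] := by
      intro h
      have h1 := congrArg (List.count ABC.c) h
      simp only [List.count_append, rep_count, List.count_nil, hα, hβ,
        List.count_replicate_self] at h1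
      rcases Nat.eq_zero_or_pos m with h0 | h0
      · have : 0 < n := by omega
        have : 0 < n * (List.count ABC.c (List.replicate (3 * N) ABC.a) + N
          + List.count ABC.c s) := Nat.mul_pos this (by omega)
        omega
      · have : 0 < m * (List.count ABC.c (List.replicate (3 * N) ABC.b) + N
          + List.count ABC.c r) := Nat.mul_pos h0 (by omega)
        omega
    have h := hM _ hne
    simp only [List.count_append, rep_count] at h
    have hv : M.val (u ++ rep α m ++ rep β n) =
        M.val u + m * M.valFrom q α + n * M.valFrom q β := by
      rw [DWA.val, M.valFrom_append (u ++ rep α m), M.valFrom_append u, M.run_append, ← hq,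
        M.run_rep q α hr, M.valFrom_rep q α hr, M.valFrom_rep q β hs, DWA.val]
    rw [← h, hv]
  have ra := (List.count_le_length (a := ABC.a) (l := r)).trans hrR
  have rb := (List.count_le_length (a := ABC.b) (l := r)).trans hrR
  have rc := (List.count_le_length (a := ABC.c) (l := r)).trans hrR
  have sa := (List.count_le_length (a := ABC.a) (l := s)).trans hsR
  have sb := (List.count_le_length (a := ABC.b) (l := s)).trans hsR
  have sc := (List.count_le_length (a := ABC.c) (l := s)).trans hsR
  have α1 : α.count ABC.a + 1 ≤ α.count ABC.c := by
    simp [hα, List.count_replicate]; omega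
  have β1 : β.count ABC.b + 1 ≤ β.count ABC.c := by
    simp [hβ, List.count_replicate]; omega
  have s1 : α.count ABC.c + β.count ABC.c + 1 ≤ α.count ABC.a + β.count ABC.a := by
    simp [hα, hβ, List.count_replicate]; omega
  have s2 : α.count ABC.c + β.count ABC.c + 1 ≤ α.count ABC.b + β.count ABC.b := by
    simp [hα, hβ, List.count_replicate]; omega
  have ua := List.count_le_length (a := ABC.a) (l := u)
  have ub := List.count_le_length (a := ABC.b) (l := u)
  have uc := List.count_le_length (a := ABC.c) (l := u)
  obtain ⟨K, hK⟩ : ∃ K, K = u.length + (M.val u).natAbs + 1 := ⟨_, rfl⟩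
  have hKu : u.length + 1 ≤ K := by omega
  have hV : M.val u < K := by omega
  have hV0 : (0 : ℤ) < K := by omega
  have p1 := Nat.mul_le_mul_left K α1
  have p2 := Nat.mul_le_mul_left K β1
  have p3 := Nat.mul_le_mul_left K s1
  have p4 := Nat.mul_le_mul_left K s2
  simp only [mul_add, mul_one] at p1 p2 p3 p4
  clear_value α β q
  clear hM hu
  have k1 := (key K 0 (by omega)).2 (Or.inr (by linarith))
  have k2 := (key 0 K (by omega)).2 (Or.inl (by linarith))
  have k3 := mt (key K K (by omega)).1 (by
    rintro (h | h)
    · linarith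
    · linarith)
  simp only [Nat.cast_zero, zero_mul, add_zero] at k1 k2
  have v2 : 0 ≤ M.valFrom q β := by
    by_contra hneg
    have : M.valFrom q β ≤ -1 := by omega
    have := mul_le_mul_of_nonneg_left this hV0.le
    linarith
  have : 0 ≤ (K : ℤ) * M.valFrom q β := by positivity
  linarith
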